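/- arXiv:2210.03784 — 2 statements merged into one kernel-verified Lean document; each statement's English description precedes it below -/
import Mathlib

section
/- Let A be a superring and S ⊆ A a nontrivial Marshall coherent subset (i.e., Marshall coherent with 0 ∉ S). Then: (1) if A is full, A/_m S is full; (2) if A is a superdomain, A/_m S is a superdomain; (3) if A is a superfield, A/_m S is a superfield. -/
universe u v

/-- A structure carrying two multivalued (set-valued) binary operations, a negation,
a zero and a one, on a type `A`. -/
structure SuperringStruct (A : Type u) where
  add : A → A → Set A
  mul : A → A → Set A
  neg : A → A
  zero : A
  one : A

namespace SuperringStruct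

variable {A : Type u}

/-- Elementwise (multivalued) sum of two subsets: `X + Y = ⋃ {x + y : x ∈ X, y ∈ Y}`. -/
def sadd (R : SuperringStruct A) (X Y : Set A) : Set A := ⋃ x ∈ X, ⋃ y ∈ Y, R.add x y

/-- Elementwise (multivalued) product of two subsets. -/
def smul (R : SuperringStruct A) (X Y : Set A) : Set A := ⋃ x ∈ X, ⋃ y ∈ Y, R.mul x y

end SuperringStruct

/-- The axioms of a superring. -/
structure IsSuperring {A : Type u} (R : SuperringStruct A) : Prop where
  add_nonempty : ∀ a b : A, (R.add a b).Nonempty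
  mul_nonempty : ∀ a b : A, (R.mul a b).Nonempty
  add_comm : ∀ a b : A, R.add a b = R.add b a
  add_M1 : ∀ a b c : A, c ∈ R.add a b → a ∈ R.add c (R.neg b) ∧ b ∈ R.add (R.neg a) c
  add_M2 : ∀ a b : A, b ∈ R.add a R.zero ↔ a = b
  add_M3 : ∀ a b c x t : A, x ∈ R.add a b → t ∈ R.add x c →
    ∃ y ∈ R.add b c, t ∈ R.add a y
  mul_comm : ∀ a b : A, R.mul a b = R.mul b a
  mul_M3 : ∀ a b c x t : A, x ∈ R.mul a b → t ∈ R.mul x c →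
    ∃ y ∈ R.mul b c, t ∈ R.mul a y
  one_mul_mem : ∀ a : A, a ∈ R.mul R.one a
  mul_zero : ∀ a : A, R.mul a R.zero = {R.zero}
  distrib : ∀ a b c x d : A, x ∈ R.add a b → d ∈ R.mul c x →
    d ∈ R.sadd (R.mul c a) (R.mul c b)
  neg_mul : ∀ a b : A, R.neg '' R.mul a b = R.mul (R.neg a) b
  mul_neg : ∀ a b : A, R.neg '' R.mul a b = R.mul a (R.neg b)

theorem IsSuperring.neg_zero {A : Type u} {R : SuperringStruct A} (h : IsSuperring R) :
    R.neg R.zero = R.zero := by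
  have h0 : R.zero ∈ R.add R.zero R.zero := (h.add_M2 R.zero R.zero).mpr rfl
  exact (h.add_M2 _ _).mp (h.add_M1 _ _ _ h0).2

/-- A superring is *full* if `d ∈ c·(a+b)` iff `d ∈ c·a + c·b`. -/
def SuperringStruct.IsFull {A : Type u} (R : SuperringStruct A) : Prop :=
  ∀ a b c d : A, (∃ x ∈ R.add a b, d ∈ R.mul c x) ↔ d ∈ R.sadd (R.mul c a) (R.mul c b)

/-- A superdomain: a superring with `0 ≠ 1` and no zero divisors. -/
def IsSuperdomain {A : Type u} (R : SuperringStruct A) : Prop :=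
  IsSuperring R ∧ R.zero ≠ R.one ∧
    ∀ a b : A, R.zero ∈ R.mul a b → a = R.zero ∨ b = R.zero

/-- A superfield: a superdomain in which every nonzero element is invertible. -/
def IsSuperfield {A : Type u} (R : SuperringStruct A) : Prop :=
  IsSuperdomain R ∧ ∀ a : A, a ≠ R.zero → ∃ b : A, R.one ∈ R.mul a b

/-- A hyperfield: a superring with single-valued product, `0 ≠ 1`,
and multiplicative inverses for nonzero elements. -/
def IsHyperfield {A : Type u} (R : SuperringStruct A) : Prop :=
  IsSuperring R ∧ (∀ a b : A, ∃ c : A, R.mul a b = {c}) ∧ R.zero ≠ R.one ∧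
    ∀ a : A, a ≠ R.zero → ∃ b : A, R.one ∈ R.mul a b

/-- An ideal of a superring: a nonempty subset `I` with `I + I ⊆ I` and `A·I ⊆ I`. -/
def IsIdeal {A : Type u} (R : SuperringStruct A) (I : Set A) : Prop :=
  I.Nonempty ∧ R.sadd I I ⊆ I ∧ R.smul Set.univ I ⊆ I

/-- A prime ideal: `1 ∉ p` and `a·b ⊆ p` implies `a ∈ p` or `b ∈ p`. -/
def IsPrimeIdeal {A : Type u} (R : SuperringStruct A) (I : Set A) : Prop :=
  R.one ∉ I ∧ ∀ a b : A, R.mul a b ⊆ I → a ∈ I ∨ b ∈ I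

/-- A strongly prime ideal: `1 ∉ p` and `(a·b) ∩ p ≠ ∅` implies `a ∈ p` or `b ∈ p`. -/
def IsStronglyPrimeIdeal {A : Type u} (R : SuperringStruct A) (I : Set A) : Prop :=
  R.one ∉ I ∧ ∀ a b : A, (R.mul a b ∩ I).Nonempty → a ∈ I ∨ b ∈ I

/-- A maximal ideal: `1 ∉ m` and the only ideals containing `m` are `m` and the whole ring. -/
def IsMaximalIdeal {A : Type u} (R : SuperringStruct A) (I : Set A) : Prop :=
  R.one ∉ I ∧ ∀ J : Set A, IsIdeal R J → I ⊆ J → J = I ∨ J = Set.univ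

/-- The ideal generated by an element: the intersection of all ideals containing it. -/
def genIdeal {A : Type u} (R : SuperringStruct A) (a : A) : Set A :=
  ⋂₀ {I : Set A | IsIdeal R I ∧ a ∈ I}

/-- Two elements are identified in the quotient `A/I` iff they have the same coset `x + I`. -/
def cosetRel {A : Type u} (R : SuperringStruct A) (I : Set A) (x y : A) : Prop :=
  R.sadd {x} I = R.sadd {y} I

/-- The quotient superring structure `A/I`, with classes `x̄ = x + I` and
multioperations `x̄ + ȳ = {z̄ : z ∈ x + y}`, `x̄·ȳ = {z̄ : z ∈ x·y}`, `-x̄ = (-x)‾`. -/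
noncomputable def quotStruct {A : Type u} (R : SuperringStruct A) (I : Set A) :
    SuperringStruct (Quot (cosetRel R I)) where
  add X Y := {Z | ∃ x y z : A,
    Quot.mk _ x = X ∧ Quot.mk _ y = Y ∧ Quot.mk _ z = Z ∧ z ∈ R.add x y}
  mul X Y := {Z | ∃ x y z : A,
    Quot.mk _ x = X ∧ Quot.mk _ y = Y ∧ Quot.mk _ z = Z ∧ z ∈ R.mul x y}
  neg X := Quot.mk _ (R.neg X.out)
  zero := Quot.mk _ R.zero
  one := Quot.mk _ R.one

/-- A morphism of superrings. -/
def IsMorphism {A : Type u} {B : Type v} (R : SuperringStruct A) (S : SuperringStruct B)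
    (f : A → B) : Prop :=
  f R.zero = S.zero ∧ f R.one = S.one ∧ (∀ a : A, f (R.neg a) = S.neg (f a)) ∧
    (∀ a b c : A, c ∈ R.add a b → f c ∈ S.add (f a) (f b)) ∧
    (∀ a b c : A, c ∈ R.mul a b → f c ∈ S.mul (f a) (f b))

/-- Marshall's relation: `a ∼_S b` iff `a·X = b·Y` for some nonempty `X, Y ⊆ S`. -/
def msRel {A : Type u} (R : SuperringStruct A) (S : Set A) (a b : A) : Prop :=
  ∃ X Y : Set A, X ⊆ S ∧ X.Nonempty ∧ Y ⊆ S ∧ Y.Nonempty ∧ R.smul {a} X = R.smul {b} Y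

/-- A Marshall coherent subset: multiplicative, and whenever `x ∈ a·s` with `s ∈ S`,
there are nonempty `P, Q ⊆ S` with `x·P = a·Q`. -/
def MarshallCoherent {A : Type u} (R : SuperringStruct A) (S : Set A) : Prop :=
  R.one ∈ S ∧ (∀ s ∈ S, ∀ v ∈ S, R.mul s v ⊆ S) ∧
    ∀ a x : A, ∀ s ∈ S, x ∈ R.mul a s →
      ∃ P Q : Set A, P ⊆ S ∧ P.Nonempty ∧ Q ⊆ S ∧ Q.Nonempty ∧
        R.smul {x} P = R.smul {a} Q

/-- The Marshall quotient superring structure `A/_m S` on the classes of `∼_S`. -/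
noncomputable def marshallStruct {A : Type u} (R : SuperringStruct A) (S : Set A) :
    SuperringStruct (Quot (msRel R S)) where
  add X Y := {Z | ∃ a b c : A,
    Quot.mk _ a = X ∧ Quot.mk _ b = Y ∧ Quot.mk _ c = Z ∧ c ∈ R.add a b}
  mul X Y := {Z | ∃ a b c : A,
    Quot.mk _ a = X ∧ Quot.mk _ b = Y ∧ Quot.mk _ c = Z ∧ c ∈ R.mul a b}
  neg X := Quot.mk _ (R.neg X.out)
  zero := Quot.mk _ R.zero
  one := Quot.mk _ R.one

/-- Finite multivalued sums: `x ∈ Σ_{i<0} g i` iff `x = 0`;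
`Σ_{i<p+1} g i = (Σ_{i<p} g i) + g p` elementwise. -/
def setSumUpTo {A : Type u} (R : SuperringStruct A) (g : ℕ → Set A) : ℕ → Set A
  | 0 => {R.zero}
  | n + 1 => R.sadd (setSumUpTo R g n) (g n)

/-- Multivalued powers: `α^0 = {1}`, `α^{n+1} = α^n · α` elementwise. -/
def setPow {A : Type u} (R : SuperringStruct A) (α : A) : ℕ → Set A
  | 0 => {R.one}
  | n + 1 => R.smul (setPow R α n) {α}

/-- The evaluation set `c 0 + c 1 · α + ⋯ + c m · α^m` (a finite multivalued sum of
multivalued products). -/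
def evalSet {A : Type u} (R : SuperringStruct A) (c : ℕ → A) (m : ℕ) (α : A) : Set A :=
  setSumUpTo R (fun j => R.smul {c j} (setPow R α j)) (m + 1)

/-- The iterated multivalued product of a list: `Π_{i<0} = {1}` and
`t ∈ f₁·…·fₙ` iff `t ∈ y·fₙ` for some `y ∈ f₁·…·f_{n-1}`. -/
def listProd {A : Type u} (R : SuperringStruct A) (l : List A) : Set A :=
  l.foldl (fun X a => R.smul X {a}) {R.one}

/-- The carrier of `R[X]`: eventually-zero sequences in `R`. -/
def PolyCarrier {A : Type u} (R : SuperringStruct A) : Type u :=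
  {f : ℕ → A // ∃ N : ℕ, ∀ n : ℕ, N ≤ n → f n = R.zero}

/-- The superring of polynomials `R[X]` with the convolution multioperations. -/
def polyStruct {A : Type u} (R : SuperringStruct A) (h : IsSuperring R) :
    SuperringStruct (PolyCarrier R) where
  add f g := {c | ∀ n : ℕ, c.1 n ∈ R.add (f.1 n) (g.1 n)}
  mul f g := {c | ∀ n : ℕ,
    c.1 n ∈ setSumUpTo R (fun j => R.mul (f.1 j) (g.1 (n - j))) (n + 1)}
  neg f := ⟨fun n => R.neg (f.1 n), by
    obtain ⟨N, hN⟩ := f.2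
    exact ⟨N, fun n hn => by
      show R.neg (f.1 n) = R.zero
      rw [hN n hn, h.neg_zero]⟩⟩
  zero := ⟨fun _ => R.zero, ⟨0, fun _ _ => rfl⟩⟩
  one := ⟨fun n => if n = 0 then R.one else R.zero, ⟨1, fun n hn => if_neg (by omega)⟩⟩

/-- The degree of a polynomial: the largest `n` with nonzero `n`-th coefficient. -/
noncomputable def polyDeg {A : Type u} (R : SuperringStruct A) (f : PolyCarrier R) : ℕ :=
  sSup {n : ℕ | f.1 n ≠ R.zero}

/-- The constant polynomial. -/
def constPoly {A : Type u} (R : SuperringStruct A) (a : A) : PolyCarrier R :=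
  ⟨fun n => if n = 0 then a else R.zero, ⟨1, fun n hn => if_neg (by omega)⟩⟩

/-- The monomial `d·X^r`. -/
def monoPoly {A : Type u} (R : SuperringStruct A) (d : A) (r : ℕ) : PolyCarrier R :=
  ⟨fun n => if n = r then d else R.zero, ⟨r + 1, fun n hn => if_neg (by omega)⟩⟩

/-- The polynomial `X`. -/
def XPoly {A : Type u} (R : SuperringStruct A) : PolyCarrier R :=
  ⟨fun n => if n = 1 then R.one else R.zero, ⟨2, fun n hn => if_neg (by omega)⟩⟩

/-- The polynomial `X - a = (-a, 1, 0, …)`. -/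
def XsubC {A : Type u} (R : SuperringStruct A) (a : A) : PolyCarrier R :=
  ⟨fun n => if n = 0 then R.neg a else if n = 1 then R.one else R.zero,
   ⟨2, fun n hn => by
     show (if n = 0 then R.neg a else if n = 1 then R.one else R.zero) = R.zero
     rw [if_neg (by omega), if_neg (by omega)]⟩⟩

/-- The polynomial obtained from `g` by putting `d` in the `r`-th coefficient. -/
def putCoeff {A : Type u} (R : SuperringStruct A) (g : PolyCarrier R) (d : A) (r : ℕ) :
    PolyCarrier R :=
  ⟨fun n => if n = r then d else g.1 n, by
    obtain ⟨N, hN⟩ := g.2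
    exact ⟨max N (r + 1), fun n hn => by
      show (if n = r then d else g.1 n) = R.zero
      rw [if_neg (by omega), hN n (by omega)]⟩⟩

/-- A polynomial `f` is irreducible if `deg f ≥ 1` and `f ∈ ⟨u⟩` implies `⟨f⟩ = ⟨u⟩`. -/
noncomputable def IsIrreduciblePoly {A : Type u} (R : SuperringStruct A) (h : IsSuperring R)
    (f : PolyCarrier R) : Prop :=
  1 ≤ polyDeg R f ∧ ∀ u : PolyCarrier R, f ∈ genIdeal (polyStruct R h) u →
    genIdeal (polyStruct R h) f = genIdeal (polyStruct R h) u

section helpers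

variable {A : Type u} {R : SuperringStruct A} {S : Set A}

theorem mem_smul' {X Y : Set A} {t : A} :
    t ∈ R.smul X Y ↔ ∃ x ∈ X, ∃ y ∈ Y, t ∈ R.mul x y := by
  simp [SuperringStruct.smul]

theorem mem_sadd' {X Y : Set A} {t : A} :
    t ∈ R.sadd X Y ↔ ∃ x ∈ X, ∃ y ∈ Y, t ∈ R.add x y := by
  simp [SuperringStruct.sadd]

theorem IsSuperring.assocR (h : IsSuperring R) {a b c y t : A} (hy : y ∈ R.mul b c)
    (ht : t ∈ R.mul a y) : ∃ x ∈ R.mul a b, t ∈ R.mul x c := by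
  rw [h.mul_comm] at hy ht
  obtain ⟨x, hx, hx'⟩ := h.mul_M3 _ _ _ _ _ hy ht
  rw [h.mul_comm] at hx hx'
  exact ⟨x, hx, hx'⟩

theorem IsSuperring.swap (h : IsSuperring R) {a s z p t : A} (hp : p ∈ R.mul a s)
    (ht : t ∈ R.mul p z) : ∃ q ∈ R.mul a z, t ∈ R.mul q s := by
  obtain ⟨y, hy, hy'⟩ := h.mul_M3 _ _ _ _ _ hp ht
  rw [h.mul_comm] at hy
  exact h.assocR hy hy'

theorem IsSuperring.smul_assoc (h : IsSuperring R) (X Y Z : Set A) :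
    R.smul (R.smul X Y) Z = R.smul X (R.smul Y Z) := by
  ext t
  simp only [mem_smul']
  constructor
  · rintro ⟨w, ⟨x, hx, y, hy, hw⟩, z, hz, ht⟩
    obtain ⟨v, hv, hv'⟩ := h.mul_M3 _ _ _ _ _ hw ht
    exact ⟨x, hx, v, ⟨y, hy, z, hz, hv⟩, hv'⟩
  · rintro ⟨x, hx, w, ⟨y, hy, z, hz, hw⟩, ht⟩
    obtain ⟨v, hv, hv'⟩ := h.assocR hw ht
    exact ⟨v, ⟨x, hx, y, hy, hv⟩, z, hz, hv'⟩

theorem IsSuperring.smul_comm (h : IsSuperring R) (X Y : Set A) :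
    R.smul X Y = R.smul Y X := by
  ext t
  simp only [mem_smul']
  constructor
  · rintro ⟨x, hx, y, hy, ht⟩
    exact ⟨y, hy, x, hx, h.mul_comm x y ▸ ht⟩
  · rintro ⟨x, hx, y, hy, ht⟩
    exact ⟨y, hy, x, hx, h.mul_comm x y ▸ ht⟩

theorem MarshallCoherent.smul_sub (hS : MarshallCoherent R S) {X Y : Set A} (hX : X ⊆ S)
    (hY : Y ⊆ S) : R.smul X Y ⊆ S := by
  intro t ht
  obtain ⟨x, hx, y, hy, ht⟩ := mem_smul'.1 ht
  exact hS.2.1 x (hX hx) y (hY hy) ht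

theorem IsSuperring.smul_ne (h : IsSuperring R) {X Y : Set A} (hX : X.Nonempty)
    (hY : Y.Nonempty) : (R.smul X Y).Nonempty := by
  obtain ⟨x, hx⟩ := hX
  obtain ⟨y, hy⟩ := hY
  obtain ⟨t, ht⟩ := h.mul_nonempty x y
  exact ⟨t, mem_smul'.2 ⟨x, hx, y, hy, ht⟩⟩

theorem msRel_equiv (h : IsSuperring R) (hS : MarshallCoherent R S) :
    Equivalence (msRel R S) where
  refl a := ⟨{R.one}, {R.one}, by simpa using hS.1, by simp, by simpa using hS.1, by simp, rfl⟩
  symm := by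
    rintro a b ⟨X, Y, h1, h2, h3, h4, h5⟩
    exact ⟨Y, X, h3, h4, h1, h2, h5.symm⟩
  trans := by
    rintro a b c ⟨X, Y, h1, h2, h3, h4, h5⟩ ⟨Z, W, k1, k2, k3, k4, k5⟩
    refine ⟨R.smul X Z, R.smul W Y, hS.smul_sub h1 k1, h.smul_ne h2 k2, hS.smul_sub k3 h3,
      h.smul_ne k4 h4, ?_⟩
    rw [← h.smul_assoc, ← h.smul_assoc, h5, ← k5, h.smul_assoc, h.smul_assoc, h.smul_comm Y Z]

theorem mk_eq (h : IsSuperring R) (hS : MarshallCoherent R S) {a b : A} :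
    Quot.mk (msRel R S) a = Quot.mk (msRel R S) b ↔ msRel R S a b := by
  rw [Quot.eq, (msRel_equiv h hS).eqvGen_iff]

theorem mk_of_mem (hS : MarshallCoherent R S) {a s x : A} (hs : s ∈ S) (hx : x ∈ R.mul a s) :
    Quot.mk (msRel R S) x = Quot.mk (msRel R S) a :=
  Quot.sound (hS.2.2 a x s hs hx)

theorem rel_ext (h : IsSuperring R) (hS : MarshallCoherent R S) {a b : A}
    (hab : Quot.mk (msRel R S) a = Quot.mk (msRel R S) b) :
    ∃ s ∈ S, ∀ t ∈ R.mul a s, ∃ s' ∈ S, t ∈ R.mul b s' := by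
  obtain ⟨X, Y, h1, ⟨x, hx⟩, h3, h4, h5⟩ := (mk_eq h hS).1 hab
  refine ⟨x, h1 hx, fun t ht => ?_⟩
  have : t ∈ R.smul {b} Y := h5 ▸ mem_smul'.2 ⟨a, rfl, x, hx, ht⟩
  obtain ⟨_, rfl, y, hy, ht⟩ := mem_smul'.1 this
  exact ⟨y, h3 hy, ht⟩

theorem addMul (h : IsSuperring R) {a b c s t : A} (hc : c ∈ R.add a b) (ht : t ∈ R.mul c s) :
    ∃ p ∈ R.mul a s, ∃ q ∈ R.mul b s, t ∈ R.add p q := by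
  rw [h.mul_comm] at ht
  have := mem_sadd'.1 (h.distrib _ _ _ _ _ hc ht)
  rwa [h.mul_comm s a, h.mul_comm s b] at this

theorem adjust (h : IsSuperring R) (hS : MarshallCoherent R S) {a a' b c : A}
    (haa : Quot.mk (msRel R S) a = Quot.mk (msRel R S) a') (hc : c ∈ R.add a b) :
    ∃ s ∈ S, ∃ s' ∈ S, ∃ p ∈ R.mul a' s', ∃ q ∈ R.mul b s, ∃ t ∈ R.mul c s, t ∈ R.add p q := by
  obtain ⟨s, hs, hs'⟩ := rel_ext h hS haa
  obtain ⟨t, ht⟩ := h.mul_nonempty c s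
  obtain ⟨p, hp, q, hq, hpq⟩ := addMul h hc ht
  obtain ⟨s', h1, h2⟩ := hs' p hp
  exact ⟨s, hs, s', h1, p, h2, q, hq, t, ht, hpq⟩

theorem mul_rep (h : IsSuperring R) (hS : MarshallCoherent R S) {a b : A}
    {Z : Quot (msRel R S)} :
    Z ∈ (marshallStruct R S).mul (Quot.mk _ a) (Quot.mk _ b) ↔
      ∃ d ∈ R.mul a b, Quot.mk _ d = Z := by
  constructor
  · rintro ⟨a', b', c, ha, hb, rfl, hc⟩
    obtain ⟨s, hs, hs'⟩ := rel_ext h hS ha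
    obtain ⟨z, hz, hz'⟩ := rel_ext h hS hb
    obtain ⟨t, ht⟩ := h.mul_nonempty c s
    obtain ⟨w, hw⟩ := h.mul_nonempty t z
    have e1 := mk_of_mem hS hs ht
    have e2 := mk_of_mem hS hz hw
    obtain ⟨p, hp, htp⟩ := h.swap hc ht
    obtain ⟨y, hy, hy'⟩ := hs' p hp
    obtain ⟨q, hq, hwq⟩ := h.mul_M3 _ _ _ _ _ htp hw
    obtain ⟨v, hv, hv'⟩ := hz' q hq
    obtain ⟨m, hm, hm'⟩ := h.assocR hv' hwq
    obtain ⟨d, hd, hd'⟩ := h.swap hy' hm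
    refine ⟨d, hd, ?_⟩
    rw [← e1, ← e2, mk_of_mem hS hv hm', mk_of_mem hS hy hd']
  · rintro ⟨d, hd, rfl⟩
    exact ⟨a, b, d, rfl, rfl, rfl, hd⟩

theorem neg_rel (h : IsSuperring R) {a b : A} (hab : msRel R S a b) :
    msRel R S (R.neg a) (R.neg b) := by
  obtain ⟨X, Y, h1, h2, h3, h4, h5⟩ := hab
  refine ⟨X, Y, h1, h2, h3, h4, ?_⟩
  have key : ∀ (c : A) (X : Set A), R.smul {R.neg c} X = R.neg '' R.smul {c} X := by
    intro c X
    simp [SuperringStruct.smul, Set.image_iUnion, h.neg_mul]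
  rw [key, key, h5]

theorem neg_mk (h : IsSuperring R) (hS : MarshallCoherent R S) (a : A) :
    (marshallStruct R S).neg (Quot.mk _ a) = Quot.mk _ (R.neg a) :=
  Quot.sound (neg_rel h ((mk_eq h hS).1 (Quot.out_eq _)))

theorem zero_rel (h : IsSuperring R) (hS : MarshallCoherent R S) {z : A}
    (hz : Quot.mk (msRel R S) z = Quot.mk _ R.zero) :
    ∃ s ∈ S, R.mul z s = {R.zero} := by
  obtain ⟨s, hs, hs'⟩ := rel_ext h hS hz
  refine ⟨s, hs, ?_⟩
  refine Set.eq_singleton_iff_nonempty_unique_mem.2 ⟨h.mul_nonempty _ _, fun t ht => ?_⟩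
  obtain ⟨v, _, hv⟩ := hs' t ht
  rw [h.mul_comm, h.mul_zero] at hv
  exact hv

theorem marshall_superring (h : IsSuperring R) (hS : MarshallCoherent R S) :
    IsSuperring (marshallStruct R S) where
  add_nonempty := by
    rintro ⟨a⟩ ⟨b⟩
    obtain ⟨c, hc⟩ := h.add_nonempty a b
    exact ⟨_, a, b, c, rfl, rfl, rfl, hc⟩
  mul_nonempty := by
    rintro ⟨a⟩ ⟨b⟩
    obtain ⟨c, hc⟩ := h.mul_nonempty a b
    exact ⟨_, a, b, c, rfl, rfl, rfl, hc⟩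
  add_comm := by
    intro X Y
    ext Z
    constructor
    · rintro ⟨a, b, c, h1, h2, h3, h4⟩
      exact ⟨b, a, c, h2, h1, h3, h.add_comm a b ▸ h4⟩
    · rintro ⟨a, b, c, h1, h2, h3, h4⟩
      exact ⟨b, a, c, h2, h1, h3, h.add_comm a b ▸ h4⟩
  add_M1 := by
    rintro X Y Z ⟨a, b, c, rfl, rfl, rfl, hc⟩
    rw [neg_mk h hS, neg_mk h hS]
    exact ⟨⟨_, _, _, rfl, rfl, rfl, (h.add_M1 _ _ _ hc).1⟩,
      ⟨_, _, _, rfl, rfl, rfl, (h.add_M1 _ _ _ hc).2⟩⟩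
  add_M2 := by
    intro X Y
    constructor
    · rintro ⟨a, z, b, rfl, hz, rfl, hb⟩
      obtain ⟨s, hs, hzs⟩ := zero_rel h hS hz
      obtain ⟨t, ht⟩ := h.mul_nonempty b s
      obtain ⟨p, hp, q, hq, hpq⟩ := addMul h hb ht
      rw [hzs] at hq
      obtain rfl : q = R.zero := hq
      obtain rfl := (h.add_M2 _ _).1 hpq
      rw [← mk_of_mem hS hs hp, mk_of_mem hS hs ht]
    · rintro rfl
      obtain ⟨a⟩ := X
      exact ⟨a, R.zero, a, rfl, rfl, rfl, (h.add_M2 _ _).2 rfl⟩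
  add_M3 := by
    rintro _ _ _ _ _ ⟨a, b, x, rfl, rfl, rfl, hx⟩ ⟨x2, c, t, hx2, rfl, rfl, ht⟩
    obtain ⟨s, hs, s', hs', p, hp, q, hq, w, hw, hpq⟩ := adjust h hS hx2 ht
    obtain ⟨a2, ha2, b2, hb2, hab⟩ := addMul h hx hp
    obtain ⟨y, hy, hy'⟩ := h.add_M3 _ _ _ _ _ hab hpq
    exact ⟨Quot.mk _ y, ⟨b2, q, y, mk_of_mem hS hs' hb2, mk_of_mem hS hs hq, rfl, hy⟩,
      ⟨a2, y, w, mk_of_mem hS hs' ha2, rfl, mk_of_mem hS hs hw, hy'⟩⟩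
  mul_comm := by
    intro X Y
    ext Z
    constructor
    · rintro ⟨a, b, c, h1, h2, h3, h4⟩
      exact ⟨b, a, c, h2, h1, h3, h.mul_comm a b ▸ h4⟩
    · rintro ⟨a, b, c, h1, h2, h3, h4⟩
      exact ⟨b, a, c, h2, h1, h3, h.mul_comm a b ▸ h4⟩
  mul_M3 := by
    rintro ⟨a⟩ ⟨b⟩ ⟨c⟩ X T hX hT
    obtain ⟨x, hx, rfl⟩ := (mul_rep h hS).1 hX
    obtain ⟨t, ht, rfl⟩ := (mul_rep h hS).1 hT
    obtain ⟨y, hy, hy'⟩ := h.mul_M3 _ _ _ _ _ hx ht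
    exact ⟨Quot.mk _ y, (mul_rep h hS).2 ⟨y, hy, rfl⟩, (mul_rep h hS).2 ⟨t, hy', rfl⟩⟩
  one_mul_mem := by
    rintro ⟨a⟩
    exact ⟨R.one, a, a, rfl, rfl, rfl, h.one_mul_mem a⟩
  mul_zero := by
    rintro ⟨a⟩
    ext Z
    refine (mul_rep h hS).trans ?_
    rw [h.mul_zero]
    constructor
    · rintro ⟨d, rfl, rfl⟩
      rfl
    · rintro rfl
      exact ⟨_, rfl, rfl⟩
  distrib := by
    rintro _ _ ⟨c⟩ _ D ⟨a, b, x, rfl, rfl, rfl, hx⟩ hD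
    obtain ⟨d, hd, rfl⟩ := (mul_rep h hS).1 hD
    obtain ⟨p, hp, q, hq, hpq⟩ := mem_sadd'.1 (h.distrib _ _ _ _ _ hx hd)
    exact mem_sadd'.2 ⟨_, (mul_rep h hS).2 ⟨p, hp, rfl⟩, _, (mul_rep h hS).2 ⟨q, hq, rfl⟩,
      ⟨p, q, d, rfl, rfl, rfl, hpq⟩⟩
  neg_mul := by
    rintro ⟨a⟩ ⟨b⟩
    ext Z
    rw [neg_mk h hS]
    refine Iff.trans ?_ (mul_rep h hS).symm
    rw [← h.neg_mul]
    constructor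
    · rintro ⟨W, hW, rfl⟩
      obtain ⟨d, hd, rfl⟩ := (mul_rep h hS).1 hW
      exact ⟨_, ⟨d, hd, rfl⟩, (neg_mk h hS d).symm⟩
    · rintro ⟨_, ⟨d, hd, rfl⟩, rfl⟩
      exact ⟨_, (mul_rep h hS).2 ⟨d, hd, rfl⟩, neg_mk h hS d⟩
  mul_neg := by
    rintro ⟨a⟩ ⟨b⟩
    ext Z
    rw [neg_mk h hS]
    refine Iff.trans ?_ (mul_rep h hS).symm
    rw [← h.mul_neg]
    constructor
    · rintro ⟨W, hW, rfl⟩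
      obtain ⟨d, hd, rfl⟩ := (mul_rep h hS).1 hW
      exact ⟨_, ⟨d, hd, rfl⟩, (neg_mk h hS d).symm⟩
    · rintro ⟨_, ⟨d, hd, rfl⟩, rfl⟩
      exact ⟨_, (mul_rep h hS).2 ⟨d, hd, rfl⟩, neg_mk h hS d⟩

theorem marshall_full (h : IsSuperring R) (hS : MarshallCoherent R S) (hF : R.IsFull) :
    (marshallStruct R S).IsFull := by
  intro X Y Z D
  constructor
  · rintro ⟨x, hx, hd⟩
    exact (marshall_superring h hS).distrib _ _ _ _ _ hx hd
  · intro hD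
    obtain ⟨a⟩ := X
    obtain ⟨b⟩ := Y
    obtain ⟨c⟩ := Z
    obtain ⟨P, hP, Q, hQ, p1, q1, d, rfl, rfl, rfl, hd⟩ := mem_sadd'.1 hD
    obtain ⟨p2, hp2, ep⟩ := (mul_rep h hS).1 hP
    obtain ⟨q2, hq2, eq⟩ := (mul_rep h hS).1 hQ
    obtain ⟨s, hs, s', hs', p3, hp3, q3, hq3, t, ht, htpq⟩ := adjust h hS ep.symm hd
    have e3 := mk_of_mem hS hs hq3
    rw [h.add_comm] at htpq
    obtain ⟨v, hv, v', hv', q4, hq4, p4, hp4, w, hw, hwpq⟩ :=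
      adjust h hS (e3.trans eq.symm) htpq
    rw [h.add_comm] at hwpq
    obtain ⟨r, hr, hp4⟩ := h.mul_M3 _ _ _ _ _ hp3 hp4
    have hrS : r ∈ S := hS.2.1 _ hs' _ hv hr
    obtain ⟨a', ha', hpa⟩ := h.mul_M3 _ _ _ _ _ hp2 hp4
    obtain ⟨b', hb', hqb⟩ := h.mul_M3 _ _ _ _ _ hq2 hq4
    obtain ⟨x, hx, hwx⟩ := (hF a' b' c w).2 (mem_sadd'.2 ⟨p4, hpa, q4, hqb, hwpq⟩)
    exact ⟨Quot.mk _ x, ⟨a', b', x, mk_of_mem hS hrS ha', mk_of_mem hS hv' hb', rfl, hx⟩,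
      ⟨c, x, w, rfl, rfl, (mk_of_mem hS hv hw).trans (mk_of_mem hS hs ht), hwx⟩⟩

theorem marshall_zero (hS : MarshallCoherent R S) (h0 : R.zero ∉ S)
    (hd : IsSuperdomain R) {d : A} (e : Quot.mk (msRel R S) d = Quot.mk _ R.zero) :
    d = R.zero := by
  obtain ⟨s, hs, hds⟩ := zero_rel hd.1 hS e
  rcases hd.2.2 d s (by rw [hds]; rfl) with hh | hh
  · exact hh
  · exact absurd (hh ▸ hs) h0

theorem marshall_domain (h : IsSuperring R) (hS : MarshallCoherent R S) (h0 : R.zero ∉ S)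
    (hd : IsSuperdomain R) : IsSuperdomain (marshallStruct R S) := by
  refine ⟨marshall_superring h hS, fun e => hd.2.1 (marshall_zero hS h0 hd e.symm).symm, ?_⟩
  rintro ⟨a⟩ ⟨b⟩ hab
  obtain ⟨d, hd1, hd2⟩ := (mul_rep h hS).1 hab
  obtain rfl := marshall_zero hS h0 hd hd2
  rcases hd.2.2 _ _ hd1 with rfl | rfl
  · exact Or.inl rfl
  · exact Or.inr rfl

end helpers

/-- For a nontrivial Marshall coherent subset `S` of `A`: if `A` is full then `A/_m S` is
full; if `A` is a superdomain then so is `A/_m S`; if `A` is a superfield then so is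
`A/_m S`. -/
theorem stmt_18 {A : Type u} (R : SuperringStruct A) (h : IsSuperring R)
    (S : Set A) (hS : MarshallCoherent R S) (h0 : R.zero ∉ S) :
    (R.IsFull → (marshallStruct R S).IsFull) ∧
    (IsSuperdomain R → IsSuperdomain (marshallStruct R S)) ∧
    (IsSuperfield R → IsSuperfield (marshallStruct R S)) := by
  refine ⟨marshall_full h hS, marshall_domain h hS h0, fun hf => ⟨marshall_domain h hS h0 hf.1, ?_⟩⟩
  rintro ⟨a⟩ ha
  obtain ⟨b, hb⟩ := hf.2 a (by rintro rfl; exact ha rfl)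
  exact ⟨Quot.mk _ b, a, b, R.one, rfl, rfl, rfl, hb⟩
end

section
/- Let A be a superdomain and S ⊆ A∖{0} a subset such that 1 ∈ S, 0 ∉ S, S·S ⊆ S, and A²∖{0} ⊆ S, where A² = ∪_{a∈A} a·a. Then S is a Marshall coherent subset of A, and the Marshall quotient A/_m S is a hyperfield; in particular, for all a, b ∈ A the product [a]·[b] in A/_m S is a singleton set. -/
universe u v

namespace Marshall19

variable {A : Type u} {R : SuperringStruct A}

theorem mem_smul {X Y : Set A} {z : A} :
    z ∈ R.smul X Y ↔ ∃ x ∈ X, ∃ y ∈ Y, z ∈ R.mul x y := by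
  simp [SuperringStruct.smul]

theorem mem_sadd {X Y : Set A} {z : A} :
    z ∈ R.sadd X Y ↔ ∃ x ∈ X, ∃ y ∈ Y, z ∈ R.add x y := by
  simp [SuperringStruct.sadd]

theorem smul_comm' (h : IsSuperring R) (X Y : Set A) : R.smul X Y = R.smul Y X := by
  ext z
  simp only [mem_smul]
  constructor
  · rintro ⟨x, hx, y, hy, hz⟩
    exact ⟨y, hy, x, hx, h.mul_comm x y ▸ hz⟩
  · rintro ⟨x, hx, y, hy, hz⟩
    exact ⟨y, hy, x, hx, h.mul_comm x y ▸ hz⟩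

theorem smul_assoc_le (h : IsSuperring R) (X Y Z : Set A) :
    R.smul (R.smul X Y) Z ⊆ R.smul X (R.smul Y Z) := by
  intro t ht
  obtain ⟨w, hw, z, hz, ht⟩ := mem_smul.1 ht
  obtain ⟨x, hx, y, hy, hw⟩ := mem_smul.1 hw
  obtain ⟨v, hv, ht⟩ := h.mul_M3 _ _ _ _ _ hw ht
  exact mem_smul.2 ⟨x, hx, v, mem_smul.2 ⟨y, hy, z, hz, hv⟩, ht⟩

theorem smul_assoc' (h : IsSuperring R) (X Y Z : Set A) :
    R.smul (R.smul X Y) Z = R.smul X (R.smul Y Z) := by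
  apply Set.Subset.antisymm (smul_assoc_le h X Y Z)
  rw [smul_comm' h X, smul_comm' h Y, smul_comm' h (R.smul X Y), smul_comm' h X Y]
  exact smul_assoc_le h Z Y X

theorem smul_swap (h : IsSuperring R) (X Y Z : Set A) :
    R.smul (R.smul X Y) Z = R.smul (R.smul X Z) Y := by
  rw [smul_assoc' h, smul_comm' h Y Z, ← smul_assoc' h]

theorem smul_four (h : IsSuperring R) (X Y Z W : Set A) :
    R.smul (R.smul X Y) (R.smul Z W) = R.smul (R.smul X Z) (R.smul Y W) := by
  rw [← smul_assoc' h, smul_swap h X Y Z, smul_assoc' h]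

theorem smul_single (a b : A) : R.smul {a} {b} = R.mul a b := by
  simp [SuperringStruct.smul]

theorem smul_nonempty (h : IsSuperring R) {X Y : Set A} (hX : X.Nonempty) (hY : Y.Nonempty) :
    (R.smul X Y).Nonempty := by
  obtain ⟨x, hx⟩ := hX
  obtain ⟨y, hy⟩ := hY
  obtain ⟨z, hz⟩ := h.mul_nonempty x y
  exact ⟨z, mem_smul.2 ⟨x, hx, y, hy, hz⟩⟩

theorem smul_mono {X Y X' Y' : Set A} (hX : X ⊆ X') (hY : Y ⊆ Y') :
    R.smul X Y ⊆ R.smul X' Y' := by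
  intro z hz
  obtain ⟨x, hx, y, hy, hz⟩ := mem_smul.1 hz
  exact mem_smul.2 ⟨x, hX hx, y, hY hy, hz⟩

variable {S : Set A}

theorem smul_sub (hSmul : ∀ s ∈ S, ∀ v ∈ S, R.mul s v ⊆ S) {X Y : Set A}
    (hX : X ⊆ S) (hY : Y ⊆ S) : R.smul X Y ⊆ S := by
  intro z hz
  obtain ⟨x, hx, y, hy, hz⟩ := mem_smul.1 hz
  exact hSmul x (hX hx) y (hY hy) hz

theorem rel_equiv (h : IsSuperring R) (hS1 : R.one ∈ S)
    (hSmul : ∀ s ∈ S, ∀ v ∈ S, R.mul s v ⊆ S) : Equivalence (msRel R S) where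
  refl a := ⟨{R.one}, {R.one}, by simpa, by simp, by simpa, by simp, rfl⟩
  symm := by
    rintro a b ⟨X, Y, h1, h2, h3, h4, h5⟩
    exact ⟨Y, X, h3, h4, h1, h2, h5.symm⟩
  trans := by
    rintro a b c ⟨X, Y, h1, h2, h3, h4, h5⟩ ⟨Z, W, k1, k2, k3, k4, k5⟩
    refine ⟨R.smul X Z, R.smul W Y, smul_sub hSmul h1 k1, smul_nonempty h h2 k2,
      smul_sub hSmul k3 h3, smul_nonempty h k4 h4, ?_⟩
    rw [← smul_assoc' h, h5, smul_swap h, k5, smul_assoc' h]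

theorem rel_of_mul (h : IsSuperring R) {a b : A} (hab : R.mul a b ⊆ S) (haa : R.mul a a ⊆ S) :
    msRel R S a b := by
  refine ⟨R.mul a b, R.mul a a, hab, h.mul_nonempty _ _, haa, h.mul_nonempty _ _, ?_⟩
  rw [← smul_single, ← smul_single, ← smul_assoc' h, smul_comm' h _ {b}]

theorem mul_ne (hd : IsSuperdomain R) {a b x : A} (ha : a ≠ R.zero) (hb : b ≠ R.zero)
    (hx : x ∈ R.mul a b) : x ≠ R.zero := by
  rintro rfl
  rcases hd.2.2 a b hx with h | h
  · exact ha h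
  · exact hb h

theorem sq_sub (hd : IsSuperdomain R)
    (hSsq : ∀ a x : A, x ∈ R.mul a a → x ≠ R.zero → x ∈ S) {a : A} (ha : a ≠ R.zero) :
    R.mul a a ⊆ S := fun x hx => hSsq a x hx (mul_ne hd ha ha hx)

theorem zero_mul' (h : IsSuperring R) (a : A) : R.mul R.zero a = {R.zero} := by
  rw [h.mul_comm, h.mul_zero]

theorem rel_mul_mem (hd : IsSuperdomain R) (hS1 : R.one ∈ S) (hS0 : R.zero ∉ S)
    (hSmul : ∀ s ∈ S, ∀ v ∈ S, R.mul s v ⊆ S)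
    (hSsq : ∀ a x : A, x ∈ R.mul a a → x ≠ R.zero → x ∈ S)
    {a x s : A} (hs : s ∈ S) (hx : x ∈ R.mul a s) : msRel R S x a := by
  have h := hd.1
  by_cases ha : a = R.zero
  · subst ha
    rw [zero_mul' h] at hx
    rw [Set.mem_singleton_iff.1 hx]
    exact (rel_equiv h hS1 hSmul).refl _
  · have hs0 : s ≠ R.zero := fun e => hS0 (e ▸ hs)
    have hx0 := mul_ne hd ha hs0 hx
    apply rel_of_mul h _ (sq_sub hd hSsq hx0)
    have h1 : R.smul {x} {a} ⊆ R.smul (R.smul {a} {s}) {a} :=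
      smul_mono (by simpa [smul_single] using hx) le_rfl
    rw [smul_swap h, smul_single, smul_single] at h1
    exact h1.trans (smul_sub hSmul (sq_sub hd hSsq ha) (by simpa))

theorem rel_of_mem_mul (hd : IsSuperdomain R) (hS1 : R.one ∈ S)
    (hSmul : ∀ s ∈ S, ∀ v ∈ S, R.mul s v ⊆ S)
    (hSsq : ∀ a x : A, x ∈ R.mul a a → x ≠ R.zero → x ∈ S)
    {a b x y : A} (hx : x ∈ R.mul a b) (hy : y ∈ R.mul a b) : msRel R S x y := by
  have h := hd.1
  by_cases ha : a = R.zero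
  · subst ha
    rw [zero_mul' h] at hx hy
    rw [Set.mem_singleton_iff.1 hx, Set.mem_singleton_iff.1 hy]
    exact (rel_equiv h hS1 hSmul).refl _
  by_cases hb : b = R.zero
  · subst hb
    rw [h.mul_zero] at hx hy
    rw [Set.mem_singleton_iff.1 hx, Set.mem_singleton_iff.1 hy]
    exact (rel_equiv h hS1 hSmul).refl _
  apply rel_of_mul h _ (sq_sub hd hSsq (mul_ne hd ha hb hx))
  have h1 : R.smul {x} {y} ⊆ R.smul (R.smul {a} {b}) (R.smul {a} {b}) :=
    smul_mono (by simpa [smul_single] using hx) (by simpa [smul_single] using hy)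
  rw [smul_four h, smul_single, smul_single, smul_single] at h1
  exact h1.trans (smul_sub hSmul (sq_sub hd hSsq ha) (sq_sub hd hSsq hb))

theorem rel_mul_congr (hd : IsSuperdomain R) (hS1 : R.one ∈ S) (hS0 : R.zero ∉ S)
    (hSmul : ∀ s ∈ S, ∀ v ∈ S, R.mul s v ⊆ S)
    (hSsq : ∀ a x : A, x ∈ R.mul a a → x ≠ R.zero → x ∈ S)
    {a b a' b' x x' : A} (ha : msRel R S a a') (hb : msRel R S b b')
    (hx : x ∈ R.mul a b) (hx' : x' ∈ R.mul a' b') : msRel R S x x' := by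
  have h := hd.1
  have E := rel_equiv h hS1 hSmul
  obtain ⟨X, X', h1, h2, h3, h4, h5⟩ := ha
  obtain ⟨Y, Y', k1, k2, k3, k4, k5⟩ := hb
  obtain ⟨s, hs⟩ := smul_nonempty h h2 k2
  obtain ⟨z, hz⟩ := h.mul_nonempty x s
  have hz1 : z ∈ R.smul (R.smul {a} {b}) (R.smul X Y) :=
    mem_smul.2 ⟨x, by rwa [smul_single], s, hs, hz⟩
  rw [smul_four h, h5, k5, smul_four h, smul_single] at hz1
  obtain ⟨w, hw, s', hs', hz'⟩ := mem_smul.1 hz1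
  have e1 : msRel R S z x := rel_mul_mem hd hS1 hS0 hSmul hSsq (smul_sub hSmul h1 k1 hs) hz
  have e2 : msRel R S z w := rel_mul_mem hd hS1 hS0 hSmul hSsq (smul_sub hSmul h3 k3 hs') hz'
  exact E.trans (E.symm e1) (E.trans e2 (rel_of_mem_mul hd hS1 hSmul hSsq hw hx'))

theorem rel_zero (hd : IsSuperdomain R) (hS0 : R.zero ∉ S) {a : A}
    (ha : msRel R S a R.zero) : a = R.zero := by
  obtain ⟨X, Y, h1, ⟨x, hx⟩, h3, ⟨y, hy⟩, h5⟩ := ha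
  have : R.zero ∈ R.smul {R.zero} Y :=
    mem_smul.2 ⟨R.zero, rfl, y, hy, by rw [zero_mul' hd.1]; rfl⟩
  rw [← h5] at this
  obtain ⟨a', ha', s, hs, h0⟩ := mem_smul.1 this
  rw [Set.mem_singleton_iff.1 ha'] at h0
  rcases hd.2.2 _ _ h0 with h | h
  · exact h
  · exact absurd (h ▸ h1 hs) hS0

theorem neg_smul (h : IsSuperring R) (a : A) (X : Set A) :
    R.smul {R.neg a} X = R.neg '' R.smul {a} X := by
  ext z
  simp only [mem_smul, Set.mem_image, Set.mem_singleton_iff, exists_eq_left]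
  constructor
  · rintro ⟨y, hy, hz⟩
    rw [← h.neg_mul] at hz
    obtain ⟨w, hw, rfl⟩ := hz
    exact ⟨w, ⟨y, hy, hw⟩, rfl⟩
  · rintro ⟨w, ⟨y, hy, hw⟩, rfl⟩
    refine ⟨y, hy, ?_⟩
    rw [← h.neg_mul]
    exact ⟨w, hw, rfl⟩

theorem rel_neg (h : IsSuperring R) {a b : A} (hab : msRel R S a b) :
    msRel R S (R.neg a) (R.neg b) := by
  obtain ⟨X, Y, h1, h2, h3, h4, h5⟩ := hab
  exact ⟨X, Y, h1, h2, h3, h4, by rw [neg_smul h, neg_smul h, h5]⟩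

end Marshall19

open Marshall19 in
/-- If `A` is a superdomain and `S ⊆ A∖{0}` is multiplicative with `1 ∈ S` and
`A²∖{0} ⊆ S`, then `S` is Marshall coherent and `A/_m S` is a hyperfield; in particular
all products `[a]·[b]` in `A/_m S` are singletons. -/
theorem stmt_19 {A : Type u} (R : SuperringStruct A) (hd : IsSuperdomain R)
    (S : Set A) (hS1 : R.one ∈ S) (hS0 : R.zero ∉ S)
    (hSmul : ∀ s ∈ S, ∀ v ∈ S, R.mul s v ⊆ S)
    (hSsq : ∀ a x : A, x ∈ R.mul a a → x ≠ R.zero → x ∈ S) :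
    MarshallCoherent R S ∧ IsHyperfield (marshallStruct R S) ∧
      ∀ a b : A, ∃ Z : Quot (msRel R S),
        (marshallStruct R S).mul (Quot.mk (msRel R S) a) (Quot.mk (msRel R S) b) = {Z} := by
  have h := hd.1
  have E := rel_equiv h hS1 hSmul
  have ex : ∀ {a b : A}, Quot.mk (msRel R S) a = Quot.mk (msRel R S) b → msRel R S a b :=
    fun {a b} e => (E.eqvGen_iff).1 (Quot.eqvGen_exact e)
  have nat : ∀ {a x s : A}, s ∈ S → x ∈ R.mul a s →
      Quot.mk (msRel R S) x = Quot.mk (msRel R S) a :=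
    fun hs hx => Quot.sound (rel_mul_mem hd hS1 hS0 hSmul hSsq hs hx)
  have hneg : ∀ a : A, (marshallStruct R S).neg (Quot.mk _ a) = Quot.mk _ (R.neg a) := by
    intro a
    exact Quot.sound (rel_neg h (ex (Quot.out_eq _)))
  have hmul : ∀ a b c : A, c ∈ R.mul a b →
      (marshallStruct R S).mul (Quot.mk _ a) (Quot.mk _ b) = {Quot.mk _ c} := by
    intro a b c hc
    ext Z
    constructor
    · rintro ⟨a', b', c', ha, hb, rfl, hc'⟩
      exact Quot.sound (rel_mul_congr hd hS1 hS0 hSmul hSsq (ex ha) (ex hb) hc' hc)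
    · intro hZ
      exact ⟨a, b, c, rfl, rfl, (Set.mem_singleton_iff.1 hZ).symm, hc⟩
  have hsing : ∀ a b : A, ∃ c ∈ R.mul a b,
      (marshallStruct R S).mul (Quot.mk _ a) (Quot.mk _ b) = {Quot.mk _ c} := by
    intro a b
    obtain ⟨c, hc⟩ := h.mul_nonempty a b
    exact ⟨c, hc, hmul a b c hc⟩
  have hadd : ∀ a b c : A, c ∈ R.add a b → Quot.mk (msRel R S) c ∈
      (marshallStruct R S).add (Quot.mk _ a) (Quot.mk _ b) :=
    fun a b c hc => ⟨a, b, c, rfl, rfl, rfl, hc⟩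
  have hz : (marshallStruct R S).zero = Quot.mk _ R.zero := rfl
  have ho : (marshallStruct R S).one = Quot.mk _ R.one := rfl
  refine ⟨⟨hS1, hSmul, fun a x s hs hx => rel_mul_mem hd hS1 hS0 hSmul hSsq hs hx⟩,
    ⟨?_, ?_, ?_, ?_⟩, ?_⟩
  · constructor
    · rintro ⟨a⟩ ⟨b⟩
      obtain ⟨c, hc⟩ := h.add_nonempty a b
      exact ⟨_, hadd a b c hc⟩
    · rintro ⟨a⟩ ⟨b⟩
      obtain ⟨c, hc, e⟩ := hsing a b
      exact ⟨Quot.mk _ c, by rw [e]; rfl⟩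
    · intro X Y
      ext Z
      constructor
      · rintro ⟨a, b, c, ha, hb, hc, hh⟩
        exact ⟨b, a, c, hb, ha, hc, h.add_comm a b ▸ hh⟩
      · rintro ⟨a, b, c, ha, hb, hc, hh⟩
        exact ⟨b, a, c, hb, ha, hc, h.add_comm a b ▸ hh⟩
    · rintro _ _ _ ⟨a, b, c, rfl, rfl, rfl, hh⟩
      rw [hneg, hneg]
      exact ⟨hadd _ _ _ (h.add_M1 _ _ _ hh).1, hadd _ _ _ (h.add_M1 _ _ _ hh).2⟩
    · intro X Y
      constructor
      · rintro ⟨a, b, c, rfl, hb, rfl, hh⟩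
        rw [rel_zero hd hS0 (ex hb), h.add_M2] at hh
        rw [hh]
      · rintro rfl
        obtain ⟨a⟩ := X
        exact hadd _ _ _ ((h.add_M2 a a).2 rfl)
    · rintro _ _ _ _ _ ⟨a, b, x, rfl, rfl, rfl, h1⟩ ⟨x', c, t, hx, rfl, rfl, h2⟩
      obtain ⟨X', X, hX'S, ⟨s', hs'⟩, hXS, -, e⟩ := ex hx
      obtain ⟨w, hw⟩ := h.mul_nonempty s' t
      obtain ⟨p, hp, q, hq, hwpq⟩ := mem_sadd.1 (h.distrib _ _ _ _ _ h2 hw)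
      have hp' : p ∈ R.smul {x'} X' := mem_smul.2 ⟨x', rfl, s', hs', h.mul_comm _ _ ▸ hp⟩
      rw [e] at hp'
      obtain ⟨x0, hx0, s, hs, hps⟩ := mem_smul.1 hp'
      rw [Set.mem_singleton_iff.1 hx0, h.mul_comm] at hps
      obtain ⟨a1, ha1, b1, hb1, hpab⟩ := mem_sadd.1 (h.distrib _ _ _ _ _ h1 hps)
      obtain ⟨y, hy, hwy⟩ := h.add_M3 _ _ _ _ _ hpab hwpq
      rw [h.mul_comm] at ha1 hb1 hq hw
      rw [← nat (hXS hs) ha1, ← nat (hXS hs) hb1, ← nat (hX'S hs') hq, ← nat (hX'S hs') hw]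
      exact ⟨Quot.mk _ y, hadd _ _ _ hy, hadd _ _ _ hwy⟩
    · rintro ⟨a⟩ ⟨b⟩
      obtain ⟨c, hc, e⟩ := hsing a b
      rw [e, hmul b a c (h.mul_comm a b ▸ hc)]
    · rintro ⟨a⟩ ⟨b⟩ ⟨c⟩ X T hX hT
      obtain ⟨x, hx, e⟩ := hsing a b
      rw [e] at hX
      rw [Set.mem_singleton_iff.1 hX] at hT
      obtain ⟨t, ht, e'⟩ := hsing x c
      rw [e'] at hT
      rw [Set.mem_singleton_iff.1 hT]
      obtain ⟨y, hy, hty⟩ := h.mul_M3 _ _ _ _ _ hx ht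
      refine ⟨Quot.mk _ y, ?_, ?_⟩
      · rw [hmul b c y hy]; rfl
      · rw [hmul a y t hty]; rfl
    · rintro ⟨a⟩
      rw [ho, hmul _ _ _ (h.one_mul_mem a)]; rfl
    · rintro ⟨a⟩
      rw [hz]
      exact hmul _ _ _ (by rw [h.mul_zero]; rfl)
    · rintro _ _ ⟨c⟩ _ D ⟨a, b, x, rfl, rfl, rfl, hx⟩ hD
      obtain ⟨d, hd', e⟩ := hsing c x
      rw [e] at hD
      rw [Set.mem_singleton_iff.1 hD]
      obtain ⟨p, hp, q, hq, hpq⟩ := mem_sadd.1 (h.distrib _ _ _ _ _ hx hd')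
      rw [hmul _ _ _ hp, hmul _ _ _ hq]
      exact mem_sadd.2 ⟨_, rfl, _, rfl, hadd _ _ _ hpq⟩
    · rintro ⟨a⟩ ⟨b⟩
      obtain ⟨c, hc, e⟩ := hsing a b
      rw [e, hneg, Set.image_singleton, hneg,
        hmul (R.neg a) b (R.neg c) (by rw [← h.neg_mul]; exact ⟨c, hc, rfl⟩)]
    · rintro ⟨a⟩ ⟨b⟩
      obtain ⟨c, hc, e⟩ := hsing a b
      rw [e, hneg, Set.image_singleton, hneg,
        hmul a (R.neg b) (R.neg c) (by rw [← h.mul_neg]; exact ⟨c, hc, rfl⟩)]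
  · rintro ⟨a⟩ ⟨b⟩
    obtain ⟨c, hc, e⟩ := hsing a b
    exact ⟨_, e⟩
  · intro e
    exact hd.2.1 (rel_zero hd hS0 (ex e.symm)).symm
  · rintro ⟨a⟩ ha
    have ha0 : a ≠ R.zero := fun e => ha (by rw [e]; rfl)
    obtain ⟨c, hc, e⟩ := hsing a a
    refine ⟨Quot.mk _ a, ?_⟩
    rw [e, ho]
    exact (nat (sq_sub hd hSsq ha0 hc) (h.one_mul_mem c)).symm
  · intro a b
    obtain ⟨c, hc, e⟩ := hsing a b
    exact ⟨_, e⟩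
end
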